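/- The number of monotone Boolean functions of 8 variables that are fixed points of the 3-cycle of Fin 8 given by (0 1 2) equals 262808891710. -/

import Mathlib

/-- Bitwise inclusion of natural numbers. -/
def bitSubset (a b : ℕ) : Bool := Nat.beq (Nat.land a b) a

/-- The truth tables, read as binary numbers, of the monotone Boolean functions of `n` variables. -/
def codes : ℕ → List ℕ
  | 0 => [0, 1]
  | n + 1 => (codes n).flatMap fun b =>
      ((codes n).filter fun a => bitSubset a b).map fun a => 2 ^ 2 ^ n * b + a

/-! Vectors indexed by a list are packed into a single number, one base `2 ^ 64` digit per entry.
The recursions below are written with `List.rec` so that the kernel evaluates them quickly. -/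

/-- The number whose base `2 ^ 64` digits are the values of `f` on `l`. -/
noncomputable def pack (f : ℕ → ℕ) (l : List ℕ) : ℕ :=
  List.rec 0 (fun a _ ih => Nat.add (f a) (Nat.mul 18446744073709551616 ih)) l

/-- The sum of `x a * z a` over the `a` in `l` with `a ⊆ b`, where `x` is packed and `z` is a
list. -/
noncomputable def packedDot (b : ℕ) (l : List ℕ) : List ℕ → ℕ → ℕ :=
  List.rec (fun _ _ => 0) (fun a _ ih Z x => List.rec 0 (fun z Z _ =>
    Bool.rec (ih Z (Nat.div x 18446744073709551616))
      (Nat.add (Nat.mul (Nat.mod x 18446744073709551616) z)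
        (ih Z (Nat.div x 18446744073709551616)))
      (bitSubset a b)) Z) l

/-- The sum of `w a` over the `a` in `l` with `a ⊆ b`. -/
noncomputable def lowerSum (b : ℕ) (l : List ℕ) : List ℕ → ℕ :=
  List.rec (fun _ => 0) (fun a _ ih ws => List.rec 0 (fun w ws _ =>
    Bool.rec (ih ws) (Nat.add w (ih ws)) (bitSubset a b)) ws) l

/-- One zeta transform over the pairs `a ⊆ b` from `L`, on a list of packed rows. -/
noncomputable def zetaStep (L Z M : List ℕ) : List ℕ :=
  L.map fun b => lowerSum b L (List.zipWith (fun b x => packedDot b L Z x) L M)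

/-- The sum of all entries at pairs `a ⊆ b` from `L`. -/
noncomputable def packedTotal (L M : List ℕ) : ℕ :=
  (List.zipWith (fun b x => packedDot b L (L.map fun _ => 1) x) L M).foldr Nat.add 0

/-- The packed indicator vectors of the up-sets of the elements of `L`. -/
noncomputable def upperPacks (L : List ℕ) : List ℕ :=
  L.map fun a' => pack (fun a => bif bitSubset a' a then 1 else 0) L

/-- The number of multichains of length `k + 1` of pairs `a ⊆ b` from `L`, computed on packed
rows. -/
noncomputable def packedChainCount (k : ℕ) (L : List ℕ) : ℕ :=
  packedTotal L
    (Nat.rec (L.map fun _ => pack (fun _ => 1) L) (fun _ => zetaStep L (upperPacks L)) k)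

theorem packedChainCount_codes_four : packedChainCount 3 (codes 4) = 262808891710 := by
  decide +kernel

theorem length_codes_four : (codes 4).length = 168 := by
  decide +kernel

/-- The number of multichains of pairs `a' ⊆ b'` from `L` with `k` elements below `(b, a)`. -/
def pairChains (L : List ℕ) : ℕ → ℕ → ℕ → ℕ
  | 0, _, _ => 1
  | k + 1, b, a => (L.map fun b' => if bitSubset b' b then
      (L.map fun a' => if bitSubset a' b' then
        pairChains L k b' a' * (if bitSubset a' a then 1 else 0) else 0).sum else 0).sum

theorem pack_cons (f : ℕ → ℕ) (a : ℕ) (l : List ℕ) :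
    pack f (a :: l) = f a + 2 ^ 64 * pack f l := rfl

theorem pack_zero (l : List ℕ) : pack (fun _ => 0) l = 0 := by
  induction l with
  | nil => rfl
  | cons a l ih => simp [pack_cons, ih]

theorem pack_add (f g : ℕ → ℕ) (l : List ℕ) :
    pack (fun a => f a + g a) l = pack f l + pack g l := by
  induction l with
  | nil => rfl
  | cons a l ih => simp only [pack_cons, ih]; ring

theorem pack_mul (c : ℕ) (f : ℕ → ℕ) (l : List ℕ) :
    pack (fun a => c * f a) l = c * pack f l := by
  induction l with
  | nil => rfl
  | cons a l ih => simp only [pack_cons, ih]; ring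

theorem pack_sum (g : ℕ → ℕ → ℕ) (s l : List ℕ) :
    pack (fun a => (s.map fun i => g i a).sum) l = (s.map fun i => pack (g i) l).sum := by
  induction s with
  | nil => simp [pack_zero]
  | cons i s ih => simp only [List.map_cons, List.sum_cons, pack_add, ih]

theorem pack_ite (p : Prop) [Decidable p] (f : ℕ → ℕ) (l : List ℕ) :
    pack (fun a => if p then f a else 0) l = if p then pack f l else 0 := by
  split_ifs
  · rfl
  · exact pack_zero l

theorem lowerSum_map (b : ℕ) (f : ℕ → ℕ) (l : List ℕ) :
    lowerSum b l (l.map f) = (l.map fun a => if bitSubset a b then f a else 0).sum := by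
  induction l with
  | nil => rfl
  | cons a l ih =>
    have h : lowerSum b (a :: l) ((a :: l).map f) = Bool.rec (lowerSum b l (l.map f))
      (Nat.add (f a) (lowerSum b l (l.map f))) (bitSubset a b) := rfl
    rw [h, ih]
    cases hb : bitSubset a b <;> simp [hb]

theorem packedDot_map (b : ℕ) (f g : ℕ → ℕ) (l : List ℕ) (hf : ∀ a, f a < 2 ^ 64) :
    packedDot b l (l.map g) (pack f l) =
      (l.map fun a => if bitSubset a b then f a * g a else 0).sum := by
  induction l with
  | nil => rfl
  | cons a l ih =>
    have h : packedDot b (a :: l) ((a :: l).map g) (pack f (a :: l)) =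
      Bool.rec (packedDot b l (l.map g) (pack f (a :: l) / 2 ^ 64))
        (Nat.add (Nat.mul (pack f (a :: l) % 2 ^ 64) (g a))
          (packedDot b l (l.map g) (pack f (a :: l) / 2 ^ 64))) (bitSubset a b) := rfl
    have hd : pack f (a :: l) / 2 ^ 64 = pack f l := by
      rw [pack_cons, Nat.add_mul_div_left _ _ (by norm_num), Nat.div_eq_of_lt (hf a), zero_add]
    have hm : pack f (a :: l) % 2 ^ 64 = f a := by
      rw [pack_cons, Nat.add_mul_mod_self_left, Nat.mod_eq_of_lt (hf a)]
    rw [h, hd, hm, ih]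
    cases hb : bitSubset a b <;> simp [hb]

theorem sum_map_le_length_mul (l : List ℕ) (f : ℕ → ℕ) (c : ℕ) (hf : ∀ a, f a ≤ c) :
    (l.map f).sum ≤ l.length * c := by
  simpa using List.sum_le_card_nsmul (l.map f) c (by simpa using fun a _ => hf a)

theorem pairChains_le (L : List ℕ) (k b a : ℕ) :
    pairChains L k b a ≤ (L.length * L.length) ^ k := by
  induction k generalizing b a with
  | zero => simp [pairChains]
  | succ k ih =>
    rw [pairChains, pow_succ', mul_assoc]
    refine sum_map_le_length_mul _ _ _ fun b' => ?_
    split_ifs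
    · refine sum_map_le_length_mul _ _ _ fun a' => ?_
      have := ih b' a'
      split_ifs <;> simp [this]
    · exact Nat.zero_le _

theorem zipWith_map_self (f : ℕ → ℕ → ℕ) (g : ℕ → ℕ) (l : List ℕ) :
    List.zipWith f l (l.map g) = l.map fun b => f b (g b) := by
  rw [List.zipWith_map_right, List.zipWith_self]

theorem zetaStep_pack (L : List ℕ) (k : ℕ) (h : ∀ b a, pairChains L k b a < 2 ^ 64) :
    zetaStep L (upperPacks L) (L.map fun b => pack (pairChains L k b) L) =
      L.map fun b => pack (pairChains L (k + 1) b) L := by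
  simp only [zetaStep, upperPacks, zipWith_map_self, lowerSum_map]
  refine List.map_congr_left fun b _ => ?_
  have e : pairChains L (k + 1) b = fun a => (L.map fun b' => if bitSubset b' b then
      (L.map fun a' => if bitSubset a' b' then
        pairChains L k b' a' * (if bitSubset a' a then 1 else 0) else 0).sum else 0).sum := rfl
  simp only [e, pack_sum, pack_ite, pack_mul, packedDot_map _ _ _ _ (h _), Bool.cond_eq_ite]

theorem packedChainCount_eq (L : List ℕ) (k : ℕ)
    (h : ∀ j ≤ k, (L.length * L.length) ^ j < 2 ^ 64) :
    packedChainCount k L = (L.map fun b => (L.map fun a =>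
      if bitSubset a b then pairChains L k b a else 0).sum).sum := by
  have rows : ∀ j ≤ k, (Nat.rec (L.map fun _ => pack (fun _ => 1) L)
      (fun _ => zetaStep L (upperPacks L)) j : List ℕ) =
      L.map fun b => pack (pairChains L j b) L := by
    intro j hj
    induction j with
    | zero => rfl
    | succ j ih =>
      rw [← zetaStep_pack L j fun b a => (pairChains_le L j b a).trans_lt (h j (by omega)),
        ← ih (by omega)]
  have hlt : ∀ b a, pairChains L k b a < 2 ^ 64 := fun b a =>
    (pairChains_le L k b a).trans_lt (h k le_rfl)
  rw [packedChainCount, rows k le_rfl, packedTotal, zipWith_map_self]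
  simp only [packedDot_map _ _ _ _ (hlt _), mul_one]
  rfl

/-- The monotone Boolean functions of `n` variables. -/
abbrev MonotoneBool (n : ℕ) : Type := {f : (Fin n → Bool) → Bool // Monotone f}

/-- The truth table of a Boolean function, read as a binary number. -/
def truthTable : (n : ℕ) → ((Fin n → Bool) → Bool) → ℕ
  | 0, f => (f ![]).toNat
  | n + 1, f => 2 ^ 2 ^ n * truthTable n (fun x => f (Fin.cons true x)) +
      truthTable n (fun x => f (Fin.cons false x))

theorem truthTable_lt (n : ℕ) (f : (Fin n → Bool) → Bool) : truthTable n f < 2 ^ 2 ^ n := by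
  induction n with
  | zero => exact (Bool.toNat_lt _).trans_eq (by norm_num)
  | succ n ih =>
    have h₁ := ih fun x => f (Fin.cons true x)
    have h₂ := ih fun x => f (Fin.cons false x)
    have h₃ : (2 : ℕ) ^ 2 ^ (n + 1) = 2 ^ 2 ^ n * 2 ^ 2 ^ n := by rw [← pow_add]; ring_nf
    rw [truthTable, h₃]
    nlinarith

theorem bitSubset_iff (a b : ℕ) : bitSubset a b ↔ a &&& b = a :=
  Iff.of_eq Nat.beq_eq

theorem bitSubset_two_pow_mul_add {k a b c d : ℕ} (ha : a < 2 ^ k) (hb : b < 2 ^ k) :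
    bitSubset (2 ^ k * c + a) (2 ^ k * d + b) ↔ bitSubset c d ∧ bitSubset a b := by
  have key : (2 ^ k * c + a) &&& (2 ^ k * d + b) = 2 ^ k * (c &&& d) + (a &&& b) := by
    refine Nat.eq_of_testBit_eq fun i => ?_
    rw [Nat.testBit_and, Nat.testBit_two_pow_mul_add _ ha, Nat.testBit_two_pow_mul_add _ hb,
      Nat.testBit_two_pow_mul_add _ (Nat.and_lt_two_pow _ hb)]
    split_ifs <;> simp
  have hab : a &&& b < 2 ^ k := Nat.and_lt_two_pow _ hb
  simp only [bitSubset_iff, key]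
  refine ⟨fun h => ?_, fun h => by rw [h.1, h.2]⟩
  have hp : 0 < 2 ^ k := by positivity
  constructor
  · have := congrArg (· / 2 ^ k) h
    simpa [Nat.mul_add_div hp, Nat.div_eq_of_lt ha, Nat.div_eq_of_lt hab] using this
  · have := congrArg (· % 2 ^ k) h
    simpa [Nat.mul_add_mod, Nat.mod_eq_of_lt ha, Nat.mod_eq_of_lt hab] using this

theorem forall_fin_succ_bool {n : ℕ} {P : (Fin (n + 1) → Bool) → Prop} :
    (∀ x, P x) ↔ (∀ x, P (Fin.cons true x)) ∧ ∀ x, P (Fin.cons false x) := by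
  simp [Fin.forall_fin_succ_pi, and_comm]

theorem bitSubset_truthTable (n : ℕ) (f g : (Fin n → Bool) → Bool) :
    bitSubset (truthTable n f) (truthTable n g) ↔ f ≤ g := by
  induction n with
  | zero =>
    have h : f ≤ g ↔ f ![] ≤ g ![] :=
      ⟨fun h => h _, fun h x => by rwa [Subsingleton.elim x ![]]⟩
    rw [h, truthTable, truthTable]
    cases f ![] <;> cases g ![] <;> decide
  | succ n ih =>
    rw [truthTable, truthTable,
      bitSubset_two_pow_mul_add (truthTable_lt _ _) (truthTable_lt _ _), ih, ih]
    simp only [Pi.le_def, forall_fin_succ_bool (P := fun x => f x ≤ g x)]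

theorem bitSubset_truthTable_monotone {n : ℕ} (f g : MonotoneBool n) :
    bitSubset (truthTable n f.1) (truthTable n g.1) ↔ f ≤ g :=
  bitSubset_truthTable n f.1 g.1

theorem monotone_cons {n : ℕ} (c : Bool) :
    Monotone fun x : Fin n → Bool => (Fin.cons c x : Fin (n + 1) → Bool) :=
  fun _ _ h => Fin.cons_le_cons.2 ⟨le_rfl, h⟩

/-- A monotone Boolean function of `n + 1` variables is a pair of comparable monotone Boolean
functions of `n` variables. -/
def monotoneBoolSucc (n : ℕ) :
    MonotoneBool (n + 1) ≃ {p : MonotoneBool n × MonotoneBool n // p.2 ≤ p.1} where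
  toFun f := ⟨(⟨fun x => f.1 (Fin.cons true x), f.2.comp (monotone_cons true)⟩,
    ⟨fun x => f.1 (Fin.cons false x), f.2.comp (monotone_cons false)⟩),
    fun _ => f.2 (Fin.cons_le_cons.2 ⟨Bool.false_le _, le_rfl⟩)⟩
  invFun p := ⟨fun x => bif x 0 then p.1.1.1 (Fin.tail x) else p.1.2.1 (Fin.tail x), by
    intro x y h
    have h₀ := h 0
    have ht : Fin.tail x ≤ Fin.tail y := fun i => h i.succ
    have h₁ := p.1.1.2 ht
    have h₂ := p.1.2.2 ht
    have h₃ := p.2 (Fin.tail y)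
    dsimp only
    revert h₀
    cases x 0 <;> cases y 0 <;> intro h₀
    exacts [h₂, h₂.trans h₃, absurd (h₀ rfl) Bool.false_ne_true, h₁]⟩
  left_inv f := by
    ext x
    induction x using Fin.consCases with
    | cons c x => cases c <;> simp
  right_inv p := by
    ext <;> simp

theorem monotoneBoolSucc_le_iff {n : ℕ} (f g : MonotoneBool (n + 1)) :
    f ≤ g ↔ (monotoneBoolSucc n f).1.1 ≤ (monotoneBoolSucc n g).1.1 ∧
      (monotoneBoolSucc n f).1.2 ≤ (monotoneBoolSucc n g).1.2 :=
  forall_fin_succ_bool (P := fun x => f.1 x ≤ g.1 x)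

open Classical in
theorem sum_monotoneBool_succ {n : ℕ} (G : MonotoneBool n → MonotoneBool n → ℕ) :
    ∑ f, G (monotoneBoolSucc n f).1.1 (monotoneBoolSucc n f).1.2 =
      ∑ b, ∑ a, if a ≤ b then G b a else 0 := by
  rw [(monotoneBoolSucc n).sum_comp fun p => G p.1.1 p.1.2, ← Fintype.sum_prod_type'
    (f := fun b a : MonotoneBool n => if a ≤ b then G b a else 0), ← Finset.sum_filter]
  exact (Finset.sum_subtype _ (by simp) fun p : MonotoneBool n × MonotoneBool n => G p.1 p.2).symm

open Classical in
theorem sum_truthTable (n : ℕ) (F : ℕ → ℕ) :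
    ∑ f : MonotoneBool n, F (truthTable n f.1) = ((codes n).map F).sum := by
  induction n generalizing F with
  | zero =>
    let e : MonotoneBool 0 ≃ Bool :=
      { toFun f := f.1 ![]
        invFun c := ⟨fun _ => c, monotone_const⟩
        left_inv f := by ext x; rw [Subsingleton.elim x ![]]
        right_inv _ := rfl }
    refine (e.sum_comp fun c => F c.toNat).trans ?_
    simp [codes, add_comm]
  | succ n ih =>
    have h := sum_monotoneBool_succ fun b a : MonotoneBool n =>
      F (2 ^ 2 ^ n * truthTable n b.1 + truthTable n a.1)
    refine h.trans ?_
    simp only [← bitSubset_truthTable_monotone]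
    have inner (b : ℕ) := ih fun a => if bitSubset a b then F (2 ^ 2 ^ n * b + a) else 0
    simp only [inner]
    rw [ih fun b => ((codes n).map fun a =>
      if bitSubset a b then F (2 ^ 2 ^ n * b + a) else 0).sum]
    rw [codes, List.map_flatMap, List.flatMap_def, List.sum_flatten, List.map_map]
    refine congrArg List.sum (List.map_congr_left fun b _ => ?_)
    simp [List.sum_map_ite, Function.comp_def]

open Classical in
/-- The number of multichains with `k` elements below `x`. -/
noncomputable def chainsBelow {α : Type*} [Fintype α] [PartialOrder α] : ℕ → α → ℕ
  | 0, _ => 1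
  | k + 1, x => ∑ y, if y ≤ x then chainsBelow k y else 0

open Classical in
theorem chainsBelow_eq_pairChains (n k : ℕ) (f : MonotoneBool (n + 1)) :
    chainsBelow k f = pairChains (codes n) k (truthTable n (monotoneBoolSucc n f).1.1.1)
      (truthTable n (monotoneBoolSucc n f).1.2.1) := by
  induction k generalizing f with
  | zero => rfl
  | succ k ih =>
    simp only [chainsBelow, pairChains, ih, monotoneBoolSucc_le_iff]
    rw [sum_monotoneBool_succ fun b a : MonotoneBool n =>
      if b ≤ (monotoneBoolSucc n f).1.1 ∧ a ≤ (monotoneBoolSucc n f).1.2 then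
        pairChains (codes n) k (truthTable n b.1) (truthTable n a.1) else 0]
    simp only [← sum_truthTable, bitSubset_truthTable_monotone]
    refine Finset.sum_congr rfl fun b _ => ?_
    split_ifs with hb
    · simp [hb]
    · simp [hb]

open Classical in
theorem sum_chainsBelow (n k : ℕ) :
    ∑ f : MonotoneBool (n + 1), chainsBelow k f = ((codes n).map fun b => ((codes n).map fun a =>
      if bitSubset a b then pairChains (codes n) k b a else 0).sum).sum := by
  simp only [chainsBelow_eq_pairChains, ← sum_truthTable, bitSubset_truthTable_monotone]
  exact sum_monotoneBool_succ fun b a : MonotoneBool n =>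
    pairChains (codes n) k (truthTable n b.1) (truthTable n a.1)

/-- Multichains of length four, listed downwards. -/
abbrev FourChain (α : Type*) [PartialOrder α] : Type _ :=
  {p : α × α × α × α // p.2.1 ≤ p.1 ∧ p.2.2.1 ≤ p.2.1 ∧ p.2.2.2 ≤ p.2.2.1}

theorem card_fourChain {α : Type*} [Fintype α] [PartialOrder α] :
    Nat.card (FourChain α) = ∑ x : α, chainsBelow 3 x := by
  classical
  rw [Nat.card_eq_fintype_card, Fintype.card_subtype, Finset.card_filter]
  simp only [Fintype.sum_prod_type, chainsBelow, ite_and]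
  refine Finset.sum_congr rfl fun x _ => Finset.sum_congr rfl fun y _ => ?_
  split_ifs
  · refine Finset.sum_congr rfl fun z _ => ?_
    split_ifs <;> simp
  · simp

/-- Prepending three bits to a five-bit vector. -/
def consThree (a b c : Bool) (y : Fin 5 → Bool) : Fin 8 → Bool :=
  ![a, b, c, y 0, y 1, y 2, y 3, y 4]

theorem consThree_mono {a b c a' b' c' : Bool} {y y' : Fin 5 → Bool} (ha : a ≤ a') (hb : b ≤ b')
    (hc : c ≤ c') (hy : y ≤ y') : consThree a b c y ≤ consThree a' b' c' y' := by
  intro i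
  fin_cases i
  exacts [ha, hb, hc, hy 0, hy 1, hy 2, hy 3, hy 4]

theorem consThree_eta (x : Fin 8 → Bool) :
    consThree (x 0) (x 1) (x 2) (fun i => x (i.natAdd 3)) = x := by
  ext i
  fin_cases i <;> rfl

theorem consThree_natAdd (a b c : Bool) (y : Fin 5 → Bool) :
    (fun i : Fin 5 => consThree a b c y (i.natAdd 3)) = y := by
  ext i
  fin_cases i <;> rfl

theorem consThree_comp_cycle (a b c : Bool) (y : Fin 5 → Bool) :
    consThree a b c y ∘ (c[0, 1, 2] : Equiv.Perm (Fin 8)) = consThree b c a y := by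
  ext i
  fin_cases i <;> rfl

/-- The entry of the chain `u₀ ≤ u₁ ≤ u₂ ≤ u₃` whose index is the number of ones among `a`, `b`
and `c`. -/
def chainEntry (u₃ u₂ u₁ u₀ a b c : Bool) : Bool :=
  (a ⊓ b ⊓ c ⊓ u₃) ⊔ ((a ⊓ b ⊔ b ⊓ c ⊔ c ⊓ a) ⊓ u₂) ⊔ ((a ⊔ b ⊔ c) ⊓ u₁) ⊔ u₀

theorem chainEntry_rotate (u₃ u₂ u₁ u₀ a b c : Bool) :
    chainEntry u₃ u₂ u₁ u₀ b c a = chainEntry u₃ u₂ u₁ u₀ a b c := by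
  cases a <;> cases b <;> cases c <;> rfl

theorem chainEntry_of_chain {u₃ u₂ u₁ u₀ : Bool} (h₂ : u₂ ≤ u₃) (h₁ : u₁ ≤ u₂) (h₀ : u₀ ≤ u₁) :
    chainEntry u₃ u₂ u₁ u₀ true true true = u₃ ∧ chainEntry u₃ u₂ u₁ u₀ true true false = u₂ ∧
      chainEntry u₃ u₂ u₁ u₀ true false false = u₁ ∧
      chainEntry u₃ u₂ u₁ u₀ false false false = u₀ := by
  revert u₃ u₂ u₁ u₀
  decide

/-- A monotone Boolean function of eight variables fixed by `(0 1 2)` depends only on the number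
of ones among the first three variables and on the other five variables. -/
def fixedEquivFourChain :
    {f : (Fin 8 → Bool) → Bool //
      Monotone f ∧ ∀ x : Fin 8 → Bool, f (x ∘ (c[0, 1, 2] : Equiv.Perm (Fin 8))) = f x} ≃
    FourChain (MonotoneBool 5) where
  toFun f :=
    ⟨(⟨fun y => f.1 (consThree true true true y),
        fun _ _ h => f.2.1 (consThree_mono le_rfl le_rfl le_rfl h)⟩,
      ⟨fun y => f.1 (consThree true true false y),
        fun _ _ h => f.2.1 (consThree_mono le_rfl le_rfl le_rfl h)⟩,
      ⟨fun y => f.1 (consThree true false false y),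
        fun _ _ h => f.2.1 (consThree_mono le_rfl le_rfl le_rfl h)⟩,
      ⟨fun y => f.1 (consThree false false false y),
        fun _ _ h => f.2.1 (consThree_mono le_rfl le_rfl le_rfl h)⟩),
      fun _ => f.2.1 (consThree_mono le_rfl le_rfl (Bool.false_le _) le_rfl),
      fun _ => f.2.1 (consThree_mono le_rfl (Bool.false_le _) le_rfl le_rfl),
      fun _ => f.2.1 (consThree_mono (Bool.false_le _) le_rfl le_rfl le_rfl)⟩
  invFun p := ⟨fun x =>
      chainEntry (p.1.1.1 fun i => x (i.natAdd 3)) (p.1.2.1.1 fun i => x (i.natAdd 3))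
        (p.1.2.2.1.1 fun i => x (i.natAdd 3)) (p.1.2.2.2.1 fun i => x (i.natAdd 3))
        (x 0) (x 1) (x 2), by
    constructor
    · intro x x' h
      have hy : (fun i : Fin 5 => x (i.natAdd 3)) ≤ fun i => x' (i.natAdd 3) := fun i => h _
      dsimp only [chainEntry]
      gcongr
      exacts [h 0, h 1, h 2, p.1.1.2 hy, h 0, h 1, h 1, h 2, h 2, h 0, p.1.2.1.2 hy,
        h 0, h 1, h 2, p.1.2.2.1.2 hy, p.1.2.2.2.2 hy]
    · intro x
      obtain ⟨a, b, c, y, rfl⟩ : ∃ a b c y, x = consThree a b c y :=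
        ⟨_, _, _, _, (consThree_eta x).symm⟩
      simp only [consThree_comp_cycle, consThree_natAdd]
      exact chainEntry_rotate _ _ _ _ a b c⟩
  left_inv := by
    rintro ⟨f, hf, hσ⟩
    ext x
    obtain ⟨a, b, c, y, rfl⟩ : ∃ a b c y, x = consThree a b c y :=
      ⟨_, _, _, _, (consThree_eta x).symm⟩
    have hrot (a b c : Bool) : f (consThree b c a y) = f (consThree a b c y) := by
      rw [← hσ (consThree a b c y), consThree_comp_cycle]
    obtain ⟨h₃, h₂, h₁, h₀⟩ := chainEntry_of_chain
      (hf (consThree_mono le_rfl le_rfl (Bool.false_le true) (le_refl y)))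
      (hf (consThree_mono le_rfl (Bool.false_le true) le_rfl (le_refl y)))
      (hf (consThree_mono (Bool.false_le true) le_rfl le_rfl (le_refl y)))
    have rotate {a b c : Bool} (h : chainEntry (f (consThree true true true y))
        (f (consThree true true false y)) (f (consThree true false false y))
        (f (consThree false false false y)) a b c = f (consThree a b c y)) :=
      (chainEntry_rotate _ _ _ _ a b c).trans (h.trans (hrot a b c).symm)
    simp only [consThree_natAdd]
    change chainEntry _ _ _ _ a b c = _
    cases a <;> cases b <;> cases c
    exacts [h₀, rotate h₁, rotate (rotate h₁), rotate (rotate h₂), h₁, rotate h₂, h₂, h₃]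
  right_inv := by
    rintro ⟨⟨f₃, f₂, f₁, f₀⟩, h₂, h₁, h₀⟩
    have key (y) := chainEntry_of_chain (h₂ y) (h₁ y) (h₀ y)
    refine Subtype.ext (Prod.ext (Subtype.ext ?_) (Prod.ext (Subtype.ext ?_)
      (Prod.ext (Subtype.ext ?_) (Subtype.ext ?_)))) <;> funext y <;>
      simp only [consThree_natAdd]
    exacts [(key y).1, (key y).2.1, (key y).2.2.1, (key y).2.2.2]

/-- The number of monotone Boolean functions of 8 variables fixed by the
permutation (0 1 2) equals 262808891710. -/
theorem card_fixed_mbf :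
    Nat.card {f : (Fin 8 → Bool) → Bool //
      Monotone f ∧ ∀ x : Fin 8 → Bool, f (x ∘ (c[0, 1, 2] : Equiv.Perm (Fin 8))) = f x} = 262808891710 := by
  classical
  rw [Nat.card_congr fixedEquivFourChain, card_fourChain, sum_chainsBelow,
    ← packedChainCount_eq _ _ (by rw [length_codes_four]; decide), packedChainCount_codes_four]
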